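/- Let A ∈ GL₂ℤ and suppose the semidirect product G_A = ℤ² ⋊_A ℤ is generated by two elements. If A is not conjugate in GL₂ℤ to (2 1; 1 1) or to −(2 1; 1 1), then any two ordered 2-element generating sets of G_A are Nielsen equivalent; if A is conjugate in GL₂ℤ to (2 1; 1 1) or to −(2 1; 1 1), then there are exactly two Nielsen equivalence classes of ordered 2-element generating sets of G_A. -/

import Mathlib

open Matrix

abbrev GL2Z := GL (Fin 2) ℤ

/-- The automorphism of `ℤ²` induced by `A ∈ GL₂ℤ`. -/
def glToAddAut (A : GL2Z) : (Fin 2 → ℤ) ≃+ (Fin 2 → ℤ) :=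
  (Matrix.GeneralLinearGroup.toLin A).toLinearEquiv.toAddEquiv

/-- The action of `ℤ` on `ℤ²` with `1` acting as `A`. -/
def phiA (A : GL2Z) : Multiplicative ℤ →* MulAut (Multiplicative (Fin 2 → ℤ)) :=
  zpowersHom _ (AddEquiv.toMultiplicative (glToAddAut A))

/-- `G_A = ℤ² ⋊_A ℤ`. -/
abbrev GA (A : GL2Z) := (Multiplicative (Fin 2 → ℤ)) ⋊[phiA A] (Multiplicative ℤ)

/-- Nielsen equivalence of ordered generating `n`-tuples: the two induced epimorphisms
from the free group differ by precomposition with an automorphism. -/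
def NielsenEquiv {G : Type*} [Group G] {n : ℕ} (S T : Fin n → G) : Prop :=
  ∃ φ : FreeGroup (Fin n) ≃* FreeGroup (Fin n),
    (FreeGroup.lift S).comp φ.toMonoidHom = FreeGroup.lift T

/-- An ordered `n`-tuple generating a group. -/
def Generates {G : Type*} [Group G] {n : ℕ} (S : Fin n → G) : Prop :=
  Subgroup.closure (Set.range S) = ⊤

/-- `A` is conjugate in `GL₂ℤ` to `(2 1; 1 1)` or to `-(2 1; 1 1)`. -/
def ConjPM21 (A : GL2Z) : Prop :=
  ∃ P : GL2Z, ((P * A * P⁻¹ : GL2Z) : Matrix (Fin 2) (Fin 2) ℤ) = !![2, 1; 1, 1] ∨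
    ((P * A * P⁻¹ : GL2Z) : Matrix (Fin 2) (Fin 2) ℤ) = -!![2, 1; 1, 1]

namespace Niel

section moves
variable {G : Type*} [Group G]

lemma refl {n : ℕ} (S : Fin n → G) : NielsenEquiv S S :=
  ⟨MulEquiv.refl _, by ext; simp⟩

lemma trans {n : ℕ} {S T U : Fin n → G} (h : NielsenEquiv S T) (h' : NielsenEquiv T U) :
    NielsenEquiv S U := by
  obtain ⟨φ, hφ⟩ := h
  obtain ⟨ψ, hψ⟩ := h'
  refine ⟨ψ.trans φ, ?_⟩
  rw [← hψ, ← hφ]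
  rfl

lemma symm {n : ℕ} {S T : Fin n → G} (h : NielsenEquiv S T) : NielsenEquiv T S := by
  obtain ⟨φ, hφ⟩ := h
  refine ⟨φ.symm, ?_⟩
  rw [← hφ]
  ext i
  simp

lemma of_words {n : ℕ} (S : Fin n → G) (u u' : Fin n → FreeGroup (Fin n))
    (h : ∀ i, FreeGroup.lift u (u' i) = FreeGroup.of i)
    (h' : ∀ i, FreeGroup.lift u' (u i) = FreeGroup.of i) :
    NielsenEquiv S (fun i => FreeGroup.lift S (u i)) := by
  refine ⟨MonoidHom.toMulEquiv (FreeGroup.lift u) (FreeGroup.lift u') ?_ ?_, ?_⟩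
  · ext i; simp [h']
  · ext i; simp [h]
  · ext i; simp

open FreeGroup in
lemma swap (x y : G) : NielsenEquiv ![x, y] ![y, x] := by
  have := of_words ![x, y] ![of 1, of 0] ![of 1, of 0]
    (by intro i; fin_cases i <;> simp) (by intro i; fin_cases i <;> simp)
  convert this using 1
  ext i; fin_cases i <;> simp

open FreeGroup in
lemma inv0 (x y : G) : NielsenEquiv ![x, y] ![x⁻¹, y] := by
  have := of_words ![x, y] ![(of 0)⁻¹, of 1] ![(of 0)⁻¹, of 1]
    (by intro i; fin_cases i <;> simp) (by intro i; fin_cases i <;> simp)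
  convert this using 1
  ext i; fin_cases i <;> simp

open FreeGroup in
lemma inv1 (x y : G) : NielsenEquiv ![x, y] ![x, y⁻¹] := by
  have := of_words ![x, y] ![of 0, (of 1)⁻¹] ![of 0, (of 1)⁻¹]
    (by intro i; fin_cases i <;> simp) (by intro i; fin_cases i <;> simp)
  convert this using 1
  ext i; fin_cases i <;> simp

open FreeGroup in
lemma mulmul (x y : G) (a b : ℤ) : NielsenEquiv ![x, y] ![y ^ a * x * y ^ b, y] := by
  have := of_words ![x, y] ![of 1 ^ a * of 0 * of 1 ^ b, of 1]
    ![of 1 ^ (-a) * of 0 * of 1 ^ (-b), of 1]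
    (by intro i; fin_cases i <;> (simp; try group)) (by intro i; fin_cases i <;> (simp; try group))
  convert this using 1
  ext i; fin_cases i <;> simp

open FreeGroup in
lemma conj (x y : G) : NielsenEquiv ![x, y] ![x, x * y * x⁻¹] := by
  have := of_words ![x, y] ![of 0, of 0 * of 1 * (of 0)⁻¹] ![of 0, (of 0)⁻¹ * of 1 * of 0]
    (by intro i; fin_cases i <;> (simp; try group)) (by intro i; fin_cases i <;> (simp; try group))
  convert this using 1
  ext i; fin_cases i <;> simp

lemma gen_iff {n : ℕ} (S : Fin n → G) :
    Generates S ↔ Function.Surjective (FreeGroup.lift S) := by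
  rw [← MonoidHom.range_eq_top, FreeGroup.range_lift_eq_closure]
  rfl

lemma gen_of {n : ℕ} {S T : Fin n → G} (h : NielsenEquiv S T) (hS : Generates S) :
    Generates T := by
  rw [gen_iff] at *
  obtain ⟨φ, hφ⟩ := h
  rw [← hφ]
  exact hS.comp φ.surjective

end moves

section semi
variable {M : Type*} [CommGroup M] (φ : Multiplicative ℤ →* MulAut M)

/-- The Euclidean algorithm on the `ℤ`-coordinates. -/
lemma euclid (k : ℕ) : ∀ x y : M ⋊[φ] Multiplicative ℤ, (Multiplicative.toAdd y.right).natAbs = k →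
    ∃ x' y' : M ⋊[φ] Multiplicative ℤ, NielsenEquiv ![x, y] ![x', y'] ∧ y'.right = 1 := by
  induction k using Nat.strong_induction_on with
  | _ k ih =>
    intro x y hk
    by_cases h0 : Multiplicative.toAdd y.right = 0
    · exact ⟨x, y, refl _, h0⟩
    · set n := Multiplicative.toAdd x.right with hn
      set m := Multiplicative.toAdd y.right with hm
      set x₁ := y ^ (0 : ℤ) * x * y ^ (-(n / m)) with hx₁
      have hr : Multiplicative.toAdd x₁.right = n % m := by
        have : Multiplicative.toAdd (SemidirectProduct.rightHom x₁) = n % m := by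
          rw [hx₁]
          simp only [map_mul, map_zpow, SemidirectProduct.rightHom_eq_right, toAdd_mul, toAdd_zpow]
          rw [← hn, ← hm]
          have := Int.emod_add_mul_ediv n m
          simp only [smul_eq_mul]
          linarith
        simpa using this
      have hlt : (Multiplicative.toAdd x₁.right).natAbs < k := by
        rw [hr]
        have h1 := Int.emod_nonneg n h0
        have h2 := Int.emod_lt_abs n h0
        rw [Int.abs_eq_natAbs, hk] at h2
        omega
      obtain ⟨x', y', h, h'⟩ := ih _ hlt y x₁ rfl
      exact ⟨x', y', trans (mulmul x y 0 (-(n / m))) (trans (swap _ _) h), h'⟩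

lemma right_pm (x y : M ⋊[φ] Multiplicative ℤ) (hy : y.right = 1) (hg : Generates ![x, y]) :
    x.right = Multiplicative.ofAdd 1 ∨ x.right = Multiplicative.ofAdd (-1) := by
  have h1 : (SemidirectProduct.inr (Multiplicative.ofAdd 1) : M ⋊[φ] Multiplicative ℤ) ∈
      (Subgroup.zpowers x.right).comap SemidirectProduct.rightHom := by
    have : Subgroup.closure (Set.range ![x, y]) ≤
        (Subgroup.zpowers x.right).comap SemidirectProduct.rightHom := by
      rw [Subgroup.closure_le]
      rintro _ ⟨i, rfl⟩
      fin_cases i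
      · simp
      · simp [hy, one_mem]
    apply this
    rw [hg]
    trivial
  simp only [Subgroup.mem_comap, SemidirectProduct.rightHom_inr, Subgroup.mem_zpowers_iff] at h1
  obtain ⟨k, hk⟩ := h1
  have : k * Multiplicative.toAdd x.right = 1 := by
    have := congrArg Multiplicative.toAdd hk
    simpa using this
  rcases Int.isUnit_iff.1 (IsUnit.of_mul_eq_one_right _ this) with h | h
  · exact Or.inl h
  · exact Or.inr h

/-- Every generating pair reduces to `(v t, w)`. -/
lemma reduce (S : Fin 2 → M ⋊[φ] Multiplicative ℤ) (hS : Generates S) :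
    ∃ v w : M, NielsenEquiv S ![⟨v, Multiplicative.ofAdd 1⟩, ⟨w, 1⟩] := by
  have e : S = ![S 0, S 1] := by ext i <;> fin_cases i <;> rfl
  obtain ⟨x, y, h, hy⟩ := euclid φ _ (S 0) (S 1) rfl
  rw [← e] at h
  rcases right_pm φ x y hy (gen_of h hS) with hx | hx
  · refine ⟨x.left, y.left, ?_⟩
    rw [← hx, ← hy]
    exact h
  · refine ⟨x⁻¹.left, y.left, ?_⟩
    have : x⁻¹.right = Multiplicative.ofAdd 1 := by simp [hx]
    rw [← hy, ← this]
    exact trans h (inv0 _ _)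

lemma normal_gen (v w : M) (N : Subgroup M) (hN : ∀ n ∈ N, φ (Multiplicative.ofAdd 1) n ∈ N)
    (hN' : ∀ n ∈ N, ∃ m ∈ N, φ (Multiplicative.ofAdd 1) m = n) (hw : w ∈ N) (m : M)
    (hm : (SemidirectProduct.inl m : M ⋊[φ] Multiplicative ℤ) ∈
      Subgroup.closure (Set.range ![(⟨v, Multiplicative.ofAdd 1⟩ : M ⋊[φ] Multiplicative ℤ),
        ⟨w, 1⟩])) :
    m ∈ N := by
  have hst : ∀ z : Multiplicative ℤ, ∀ n ∈ N, φ z n ∈ N := by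
    suffices H : ∀ k : ℤ, ∀ n ∈ N, φ (Multiplicative.ofAdd k) n ∈ N from fun z => H z.toAdd
    intro k
    clear hm
    induction k using Int.induction_on with
    | zero => intro n hn; simpa using hn
    | succ i ih =>
      intro n hn
      rw [ofAdd_add, map_mul, MulAut.mul_apply]
      exact ih _ (hN _ hn)
    | pred i ih =>
      intro n hn
      obtain ⟨m, hm, rfl⟩ := hN' n hn
      rw [← MulAut.mul_apply, ← map_mul, ← ofAdd_add, sub_add_cancel]
      exact ih _ hm
  set x : M ⋊[φ] Multiplicative ℤ := ⟨v, Multiplicative.ofAdd 1⟩ with hx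
  set N' : Subgroup (M ⋊[φ] Multiplicative ℤ) := N.map SemidirectProduct.inl with hN'
  have hnorm : N'.Normal := by
    constructor
    rintro _ ⟨n, hn, rfl⟩ g
    refine ⟨φ g.right n, hst _ _ hn, ?_⟩
    ext
    · simp [mul_comm]
    · simp
  have hle : Subgroup.closure (Set.range ![x, ⟨w, 1⟩]) ≤ N' ⊔ Subgroup.zpowers x := by
    rw [Subgroup.closure_le]
    rintro _ ⟨i, rfl⟩
    fin_cases i
    · exact Subgroup.mem_sup_right (Subgroup.mem_zpowers x)
    · exact Subgroup.mem_sup_left ⟨w, hw, rfl⟩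
  obtain ⟨_, ⟨n, hn, rfl⟩, _, ⟨k, rfl⟩, h⟩ := Subgroup.mem_sup_of_normal_left.1 (hle hm)
  have hk : k = 0 := by
    have := congrArg (fun g => Multiplicative.toAdd (SemidirectProduct.rightHom g)) h
    simp only [map_mul, map_zpow, SemidirectProduct.rightHom_inl] at this
    simpa [hx, -SemidirectProduct.mk_eq_inl_mul_inr] using this
  subst hk
  have : n = m := by simpa using h
  exact this ▸ hn

end semi


end Niel

namespace Niel

lemma sq_eq_one' {s : ℤ} (h : s ^ 2 = 1) : s = 1 ∨ s = -1 := by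
  simpa using h

/-- Descent, determinant `-1`. -/
lemma descent_neg (τ : ℤ) (hτ : 0 ≤ τ) (P : ℤ → ℤ → Prop)
    (hneg : ∀ a b, P a b → P (-a) (-b))
    (hstep : ∀ a b, P a b ↔ P b (a + τ * b)) (h1 : P 1 0) (k : ℕ) :
    ∀ (s : ℤ), s ^ 2 = 1 → ∀ a b : ℤ, a.natAbs + b.natAbs = k →
      a ^ 2 + τ * a * b - b ^ 2 = s → P a b := by
  have hP : ∀ a b, P (-a) (-b) → P a b := fun a b h => by simpa using hneg _ _ h
  have h01 : P 0 1 := by have := (hstep 1 0).1 h1; simpa using this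
  induction k using Nat.strong_induction_on with
  | _ k ih =>
    have main : ∀ (s : ℤ), s ^ 2 = 1 → ∀ a b : ℤ, 0 ≤ a → a.natAbs + b.natAbs = k →
      a ^ 2 + τ * a * b - b ^ 2 = s → P a b := by
      intro s hs a b ha hk hN
      have hs1 : s ≤ 1 := by nlinarith
      have hs2 : -1 ≤ s := by nlinarith
      have hs0 : s ≠ 0 := by rintro rfl; simp at hs
      rcases ha.eq_or_lt with rfl | ha
      · have h2 : b ^ 2 = 1 := by
          have : b ^ 2 = - s := by linarith
          have : 0 ≤ b ^ 2 := sq_nonneg b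
          rcases sq_eq_one' hs with h | h <;> linarith
        rcases sq_eq_one' h2 with rfl | rfl
        · exact h01
        · exact hP _ _ (by simpa using h01)
      rcases lt_trichotomy b 0 with hb | rfl | hb
      · have h3 : 0 ≤ a + τ * b := by
          by_contra h
          push Not at h
          have : a * (a + τ * b) ≤ -a := by nlinarith
          have : a * (a + τ * b) = s + b ^ 2 := by linarith
          nlinarith
        have h4 : τ * b < 0 := by
          rcases hτ.eq_or_lt with rfl | h
          · exfalso
            rcases lt_trichotomy a (-b) with h | h | h
            · nlinarith
            · apply hs0; rw [← hN, h]; ring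
            · nlinarith
          · nlinarith
        rw [hstep]
        refine ih ((b).natAbs + (a + τ * b).natAbs) (by omega) (-s) (by simpa using hs) b _ rfl ?_
        rw [← hN]; ring
      · have : a ^ 2 = 1 := by
          rcases sq_eq_one' hs with h | h <;> nlinarith
        have : a = 1 := by nlinarith
        exact this ▸ h1
      · have h3 : 0 ≤ b - τ * a := by
          by_contra h
          push Not at h
          have : b * (b - τ * a) ≤ -b := by nlinarith
          have : b * (b - τ * a) = a ^ 2 - s := by linarith
          nlinarith
        have h4 : 0 < τ * a := by
          rcases hτ.eq_or_lt with rfl | h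
          · exfalso
            rcases lt_trichotomy a b with h | h | h
            · nlinarith
            · apply hs0; rw [← hN, h]; ring
            · nlinarith
          · nlinarith
        have := ih ((b - τ * a).natAbs + a.natAbs) (by omega) (-s) (by simpa using hs) _ a rfl
          (by rw [← hN]; ring)
        rw [hstep] at this
        simpa using this
    intro s hs a b hk hN
    rcases le_total 0 a with ha | ha
    · exact main s hs a b ha hk hN
    · exact hP _ _ (main s hs (-a) (-b) (by omega) (by omega) (by rw [← hN]; ring))

/-- Descent, determinant `1`. -/
lemma descent_pos (τ : ℤ) (hτ : 0 ≤ τ) (P : ℤ → ℤ → Prop)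
    (hneg : ∀ a b, P a b → P (-a) (-b))
    (hstep : ∀ a b, P a b ↔ P (-b) (a + τ * b)) (h1 : P 1 0)
    (hex : τ = 3 → P 1 (-1)) (k : ℕ) :
    ∀ (s : ℤ), s ^ 2 = 1 → ∀ a b : ℤ, a.natAbs + b.natAbs = k →
      a ^ 2 + τ * a * b + b ^ 2 = s → P a b := by
  have hP : ∀ a b, P (-a) (-b) → P a b := fun a b h => by simpa using hneg _ _ h
  have h01 : P 0 1 := by have := (hstep 1 0).1 h1; simpa using this
  induction k using Nat.strong_induction_on with
  | _ k ih =>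
    have main : ∀ (s : ℤ), s ^ 2 = 1 → ∀ a b : ℤ, 0 ≤ a → a.natAbs + b.natAbs = k →
      a ^ 2 + τ * a * b + b ^ 2 = s → P a b := by
      intro s hs a b ha hk hN
      have hs1 : s ≤ 1 := by nlinarith
      have hs2 : -1 ≤ s := by nlinarith
      have hs0 : s ≠ 0 := by rintro rfl; simp at hs
      rcases ha.eq_or_lt with rfl | ha
      · have h2 : b ^ 2 = 1 := by
          have : b ^ 2 = s := by linarith
          have : 0 ≤ b ^ 2 := sq_nonneg b
          rcases sq_eq_one' hs with h | h <;> linarith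
        rcases sq_eq_one' h2 with rfl | rfl
        · exact h01
        · exact hP _ _ (by simpa using h01)
      rcases lt_trichotomy b 0 with hb | rfl | hb
      · obtain ⟨c, rfl⟩ : ∃ c, b = -c := ⟨-b, by ring⟩
        have hc : 0 < c := by omega
        rcases lt_trichotomy a c with h | rfl | h
        · -- apply the inverse
          have e : c * (τ * a - c) = a ^ 2 - s := by linarith
          have h3 : 0 ≤ τ * a - c := by
            by_contra h
            push Not at h
            nlinarith
          have h4 : τ * a - c < c := by
            by_contra h
            push Not at h
            nlinarith
          have := ih ((τ * a - c).natAbs + (-a).natAbs) (by omega) s hs (τ * a - c) (-a) rfl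
            (by rw [← hN]; ring)
          rw [hstep] at this
          convert this using 1 <;> ring
        · have e : (2 - τ) * a ^ 2 = s := by linarith
          have ha1 : a ^ 2 = 1 := by
            have : (a ^ 2) ∣ s := ⟨2 - τ, by linarith⟩
            have h5 : a ^ 2 ∣ 1 := this.trans (by rw [← hs]; exact dvd_pow_self _ two_ne_zero)
            exact Int.eq_one_of_dvd_one (sq_nonneg a) h5
          have : a = 1 := by nlinarith
          subst this
          rcases sq_eq_one' hs with h | h
          · have : τ = 1 := by linarith
            subst this
            have := (hstep 0 (-1)).1 (hP _ _ (by simpa using h01))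
            simpa using this
          · exact hex (by linarith)
        · have e : a * (τ * c - a) = c ^ 2 - s := by linarith
          have h3 : 0 ≤ τ * c - a := by
            by_contra h
            push Not at h
            nlinarith
          have h4 : τ * c - a < a := by
            by_contra h
            push Not at h
            nlinarith
          rw [hstep]
          refine ih _ ?_ s hs _ _ rfl (by rw [← hN]; ring)
          have : a + τ * (-c) = -(τ * c - a) := by ring
          rw [this]
          omega
      · have : a ^ 2 = 1 := by
          rcases sq_eq_one' hs with h | h <;> nlinarith
        have : a = 1 := by nlinarith
        exact this ▸ h1
      · exfalso
        have : 0 ≤ τ * a * b := by positivity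
        nlinarith
    intro s hs a b hk hN
    rcases le_total 0 a with ha | ha
    · exact main s hs a b ha hk hN
    · exact hP _ _ (main s hs (-a) (-b) (by omega) (by omega) (by rw [← hN]; ring))

/-- The unit computation in `ℤ[x]/(x² - τ x + d)`. -/
lemma descent (τ d : ℤ) (hd : d ^ 2 = 1) (P : ℤ → ℤ → Prop)
    (hneg : ∀ a b, P a b → P (-a) (-b))
    (hstep : ∀ a b, P a b ↔ P (-d * b) (a + τ * b)) (h1 : P 1 0)
    (hex : d = 1 → τ = 3 → P 1 (-1)) (hex' : d = 1 → τ = -3 → P 1 1)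
    (s : ℤ) (hs : s ^ 2 = 1) (a b : ℤ) (hN : a ^ 2 + τ * a * b + d * b ^ 2 = s) : P a b := by
  have hP : ∀ a b, P (-a) (-b) ↔ P a b :=
    fun a b => ⟨fun h => by simpa using hneg _ _ h, hneg a b⟩
  rcases sq_eq_one' hd with rfl | rfl
  · rcases le_total 0 τ with h | h
    · refine descent_pos τ h P hneg (fun a b => ?_) h1 (hex rfl) _ s hs a b rfl (by linarith)
      rw [hstep]; ring_nf
    · have := descent_pos (-τ) (by linarith) (fun a b => P a (-b)) (fun a b h => hneg _ _ h)
        (fun a b => ?_) (by simpa using h1) (fun h => by simpa using hex' rfl (by linarith))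
        _ s hs a (-b) rfl (by linarith)
      · simpa using this
      · rw [hstep, ← hP]; ring_nf
  · rcases le_total 0 τ with h | h
    · refine descent_neg τ h P hneg (fun a b => ?_) h1 _ s hs a b rfl (by linarith)
      rw [hstep]; ring_nf
    · have := descent_neg (-τ) (by linarith) (fun a b => P a (-b)) (fun a b h => hneg _ _ h)
        (fun a b => ?_) (by simpa using h1)
        _ s hs a (-b) rfl (by linarith)
      · simpa using this
      · rw [hstep, ← hP]; ring_nf

end Niel

namespace Niel

open Multiplicative (ofAdd toAdd)

/-- The matrix of `A`. -/
abbrev mat (A : GL2Z) : Matrix (Fin 2) (Fin 2) ℤ := (A : Matrix (Fin 2) (Fin 2) ℤ)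

/-- Element `(v, 1)`. -/
def tt (A : GL2Z) (v : Fin 2 → ℤ) : GA A := ⟨ofAdd v, ofAdd 1⟩

/-- Element `(v, 0)`. -/
def el (A : GL2Z) (v : Fin 2 → ℤ) : GA A := ⟨ofAdd v, 1⟩

lemma glToAddAut_apply (A : GL2Z) (v : Fin 2 → ℤ) : glToAddAut A v = mat A *ᵥ v := rfl

lemma phi_one (A : GL2Z) (v : Fin 2 → ℤ) :
    phiA A (ofAdd 1) (ofAdd v) = ofAdd (mat A *ᵥ v) := by
  simp only [phiA, zpowersHom_apply, toAdd_ofAdd, zpow_one]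
  rfl

lemma phi_zpow (A : GL2Z) (k : ℤ) : ∀ (v : Fin 2 → ℤ),
    phiA A (ofAdd k) (ofAdd v) = ofAdd (mat (A ^ k) *ᵥ v) := by
  induction k using Int.induction_on with
  | zero => intro v; simp
  | succ i ih =>
    intro v
    rw [ofAdd_add, map_mul, MulAut.mul_apply, phi_one, ih, _root_.zpow_add, _root_.zpow_one]
    rw [mat, mat, mat, Units.val_mul, Matrix.mulVec_mulVec]
  | pred i ih =>
    intro v
    have : v = mat A *ᵥ (mat A⁻¹ *ᵥ v) := by
      rw [Matrix.mulVec_mulVec, mat, mat, ← Units.val_mul]; simp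
    conv_lhs => rw [this]
    rw [← phi_one, ← MulAut.mul_apply, ← map_mul, ← ofAdd_add, sub_add_cancel, ih,
      Matrix.mulVec_mulVec, mat, mat, ← Units.val_mul, sub_eq_add_neg, _root_.zpow_add, _root_.zpow_neg_one]

lemma el_mul (A : GL2Z) (v w : Fin 2 → ℤ) : el A v * el A w = el A (v + w) := by
  ext
  · simp [el, SemidirectProduct.mul_left, -SemidirectProduct.mk_eq_inl_mul_inr]
  · simp [el, SemidirectProduct.mul_left, -SemidirectProduct.mk_eq_inl_mul_inr]

lemma el_tt (A : GL2Z) (v w : Fin 2 → ℤ) : el A v * tt A w = tt A (v + w) := by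
  rw [el, tt, SemidirectProduct.mul_def]
  simp [tt]

lemma tt_el (A : GL2Z) (v w : Fin 2 → ℤ) : tt A v * el A w = tt A (v + mat A *ᵥ w) := by
  rw [el, tt, SemidirectProduct.mul_def]
  simp only [phi_one]
  rfl

lemma el_inl (A : GL2Z) (v : Fin 2 → ℤ) : el A v = SemidirectProduct.inl (ofAdd v) := rfl

lemma el_zpow (A : GL2Z) (v : Fin 2 → ℤ) (k : ℤ) : el A v ^ k = el A (k • v) := by
  rw [el_inl, el_inl, ofAdd_zsmul, map_zpow]

lemma el_inv (A : GL2Z) (v : Fin 2 → ℤ) : (el A v)⁻¹ = el A (-v) := by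
  rw [el_inl, el_inl, ofAdd_neg, map_inv]

lemma el_inj (A : GL2Z) {v w : Fin 2 → ℤ} (h : el A v = el A w) : v = w := by
  rw [el_inl, el_inl] at h
  exact Multiplicative.ofAdd.injective (SemidirectProduct.inl_injective h)

lemma tt_conj (A : GL2Z) (v w : Fin 2 → ℤ) :
    tt A v * el A w * (tt A v)⁻¹ = el A (mat A *ᵥ w) := by
  rw [mul_inv_eq_iff_eq_mul, tt_el, el_tt, add_comm]

/-- `det (v, A v)`. -/
def D (A : GL2Z) (v : Fin 2 → ℤ) : ℤ := v 0 * (mat A *ᵥ v) 1 - v 1 * (mat A *ᵥ v) 0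

lemma D_eq (A : GL2Z) (v : Fin 2 → ℤ) : D A v =
    v 0 * (mat A 1 0 * v 0 + mat A 1 1 * v 1) - v 1 * (mat A 0 0 * v 0 + mat A 0 1 * v 1) := by
  simp [D, Matrix.mulVec, dotProduct, Fin.sum_univ_two]

lemma cayley (A : GL2Z) (w : Fin 2 → ℤ) :
    mat A *ᵥ (mat A *ᵥ w) = (mat A).trace • (mat A *ᵥ w) - (mat A).det • w := by
  ext i
  fin_cases i <;>
  · simp [Matrix.det_fin_two, Matrix.trace_fin_two]
    ring

lemma mat_comb (A : GL2Z) (w : Fin 2 → ℤ) (a b : ℤ) :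
    mat A *ᵥ (a • w + b • (mat A *ᵥ w)) =
      (-(mat A).det * b) • w + (a + (mat A).trace * b) • (mat A *ᵥ w) := by
  rw [Matrix.mulVec_add, Matrix.mulVec_smul, Matrix.mulVec_smul, cayley]
  module

lemma D_comb (A : GL2Z) (w : Fin 2 → ℤ) (a b : ℤ) :
    D A (a • w + b • (mat A *ᵥ w)) =
      (a ^ 2 + (mat A).trace * a * b + (mat A).det * b ^ 2) * D A w := by
  rw [D_eq, D_eq]
  simp [Matrix.mulVec, dotProduct, Fin.sum_univ_two, Matrix.det_fin_two, Matrix.trace_fin_two]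
  ring

lemma det_sq (A : GL2Z) : (mat A).det ^ 2 = 1 := by
  have h : IsUnit (mat A).det := (Matrix.isUnit_iff_isUnit_det _).1 A.isUnit
  rcases Int.isUnit_iff.1 h with h | h <;> rw [h] <;> norm_num

lemma comb_of_D (A : GL2Z) (w : Fin 2 → ℤ) (h : D A w ^ 2 = 1) (v : Fin 2 → ℤ) :
    ∃ a b : ℤ, v = a • w + b • (mat A *ᵥ w) := by
  refine ⟨D A w * (v 0 * (mat A *ᵥ w) 1 - v 1 * (mat A *ᵥ w) 0),
    D A w * (w 0 * v 1 - w 1 * v 0), ?_⟩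
  have e : ∀ i, v i = D A w * (D A w * v i) := fun i => by rw [← mul_assoc, ← sq, h, one_mul]
  ext i
  rw [e i]
  fin_cases i <;>
  · simp [D]
    ring

lemma D_of_gen (A : GL2Z) (v w : Fin 2 → ℤ) (hg : Generates ![tt A v, el A w]) :
    D A w ^ 2 = 1 := by
  have key : ∀ m : Fin 2 → ℤ, ∃ a b : ℤ, m = a • w + b • (mat A *ᵥ w) := by
    let N : AddSubgroup (Fin 2 → ℤ) :=
      { carrier := {m | ∃ a b : ℤ, m = a • w + b • (mat A *ᵥ w)}
        add_mem' := by
          rintro _ _ ⟨a, b, rfl⟩ ⟨a', b', rfl⟩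
          exact ⟨a + a', b + b', by module⟩
        zero_mem' := ⟨0, 0, by simp⟩
        neg_mem' := by
          rintro _ ⟨a, b, rfl⟩
          exact ⟨-a, -b, by module⟩ }
    intro m
    have hd := det_sq A
    refine normal_gen (phiA A) (ofAdd v) (ofAdd w) (AddSubgroup.toSubgroup N) ?_ ?_ ?_ (ofAdd m) ?_
    · rintro _ ⟨a, b, rfl⟩
      refine ⟨_, _, mat_comb A w a b⟩
    · rintro n ⟨a, b, hab⟩
      refine ⟨ofAdd ((b + (mat A).det * (mat A).trace * a) • w +
        (-(mat A).det * a) • (mat A *ᵥ w)), ⟨_, _, rfl⟩, ?_⟩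
      rw [phi_one, mat_comb]
      have hn : n = ofAdd (a • w + b • (mat A *ᵥ w)) := hab
      rw [hn]
      congr 2
      · congr 1; linear_combination a * hd
      · congr 1; ring
    · exact ⟨1, 0, by simp⟩
    · have : Subgroup.closure (Set.range ![tt A v, el A w]) = ⊤ := hg
      rw [tt, el] at this
      rw [this]
      trivial
  obtain ⟨a, b, h0⟩ := key ![1, 0]
  obtain ⟨c, e, h1⟩ := key ![0, 1]
  have h00 := congrFun h0 0
  have h01 := congrFun h0 1
  have h10 := congrFun h1 0
  have h11 := congrFun h1 1
  simp at h00 h01 h10 h11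
  have : (a * e - b * c) * D A w = 1 := by
    rw [D_eq]
    linear_combination (-1 : ℤ) * h11 - (c * w 1 + e * (mat A 1 0 * w 0 + mat A 1 1 * w 1)) * h00 +
      (c * w 0 + e * (mat A 0 0 * w 0 + mat A 0 1 * w 1)) * h01
  rcases Int.isUnit_iff.1 (IsUnit.of_mul_eq_one_right _ this) with h | h <;> rw [h] <;> norm_num

lemma gen_of_D (A : GL2Z) (w : Fin 2 → ℤ) (h : D A w ^ 2 = 1) :
    Generates ![tt A 0, el A w] := by
  have ht : tt A 0 ∈ Subgroup.closure (Set.range ![tt A 0, el A w]) :=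
    Subgroup.subset_closure ⟨0, rfl⟩
  have hw : el A w ∈ Subgroup.closure (Set.range ![tt A 0, el A w]) :=
    Subgroup.subset_closure ⟨1, rfl⟩
  rw [Generates, eq_top_iff]
  intro g _
  obtain ⟨a, b, hab⟩ := comb_of_D A w h (toAdd g.left)
  have h1 : g = el A w ^ a * (tt A 0 * el A w * (tt A 0)⁻¹) ^ b * tt A 0 ^ (toAdd g.right) := by
    rw [tt_conj, el_zpow, el_zpow, el_mul, ← hab]
    have : tt A 0 = SemidirectProduct.inr (ofAdd 1) := rfl
    rw [this, ← map_zpow, ← ofAdd_zsmul, el_inl]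
    simp
  rw [h1]
  exact mul_mem (mul_mem (zpow_mem hw _) (zpow_mem (mul_mem (mul_mem ht hw) (inv_mem ht)) _))
    (zpow_mem ht _)

/-- Every generating pair is equivalent to a standard pair. -/
lemma std (A : GL2Z) (S : Fin 2 → GA A) (hS : Generates S) :
    ∃ w, NielsenEquiv S ![tt A 0, el A w] ∧ D A w ^ 2 = 1 := by
  obtain ⟨v, w, h⟩ := reduce (phiA A) S hS
  have h' : NielsenEquiv S ![tt A (toAdd v), el A (toAdd w)] := h
  have hD := D_of_gen A _ _ (gen_of h' hS)
  refine ⟨toAdd w, ?_, hD⟩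
  obtain ⟨a, b, hab⟩ := comb_of_D A _ hD (toAdd v)
  refine trans h' ?_
  have := mulmul (tt A (toAdd v)) (el A (toAdd w)) (-a) (-b)
  rw [el_zpow, el_zpow, el_tt, tt_el, Matrix.mulVec_smul, hab] at this
  convert this using 3
  module

lemma core (A : GL2Z) (w : Fin 2 → ℤ) (hw : D A w ^ 2 = 1) (Q : (Fin 2 → ℤ) → Prop)
    (hneg : ∀ v, Q v → Q (-v)) (hstep : ∀ v, Q v ↔ Q (mat A *ᵥ v)) (h1 : Q w)
    (hex : (mat A).det = 1 → (mat A).trace = 3 → Q ((1 : ℤ) • w + (-1 : ℤ) • (mat A *ᵥ w)))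
    (hex' : (mat A).det = 1 → (mat A).trace = -3 → Q ((1 : ℤ) • w + (1 : ℤ) • (mat A *ᵥ w)))
    (w' : Fin 2 → ℤ) (hw' : D A w' ^ 2 = 1) : Q w' := by
  obtain ⟨a, b, rfl⟩ := comb_of_D A w hw w'
  rw [D_comb, mul_pow, hw, mul_one] at hw'
  refine descent (mat A).trace (mat A).det (det_sq A) (fun a b => Q (a • w + b • (mat A *ᵥ w)))
    ?_ ?_ ?_ hex hex' _ hw' a b rfl
  · intro a b h
    have := hneg _ h
    convert this using 1
    module
  · intro a b
    rw [hstep, mat_comb]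
  · simpa using h1

lemma nie_neg (A : GL2Z) (v : Fin 2 → ℤ) :
    NielsenEquiv ![tt A 0, el A (-v)] ![tt A 0, el A v] := by
  have := inv1 (tt A 0) (el A v)
  rw [el_inv] at this
  exact symm this

lemma nie_step (A : GL2Z) (v : Fin 2 → ℤ) :
    NielsenEquiv ![tt A 0, el A v] ![tt A 0, el A (mat A *ᵥ v)] := by
  have := conj (tt A 0) (el A v)
  rwa [tt_conj] at this

end Niel

namespace Niel

open Multiplicative (ofAdd toAdd)
open LaurentPolynomial

lemma laurent_unit (u v : ℤ[T;T⁻¹]) (huv : u * v = 1) :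
    ∃ (k : ℤ) (s : ℤ), (s = 1 ∨ s = -1) ∧ u = s • T k := by
  obtain ⟨n, f, hf⟩ := exists_T_pow u
  obtain ⟨m, g, hg⟩ := exists_T_pow v
  have h : f * g = Polynomial.X ^ (n + m) := by
    apply Polynomial.toLaurent_injective
    rw [map_mul, hf, hg, map_pow, Polynomial.toLaurent_X, T_pow]
    calc u * T n * (v * T m) = (u * v) * (T n * T m) := by ring
      _ = _ := by rw [huv, one_mul, ← T_add]; simp
  obtain ⟨i, _, hi⟩ := (dvd_prime_pow Polynomial.prime_X _).1 (Dvd.intro g h)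
  obtain ⟨c, hc⟩ := hi.symm
  obtain ⟨r, hr, hrc⟩ := Polynomial.isUnit_iff.1 c.isUnit
  refine ⟨i - n, r, Int.isUnit_iff.1 hr, ?_⟩
  have hu : u = Polynomial.toLaurent f * T (-n) := by
    rw [hf, mul_assoc, ← T_add]; simp
  rw [hu, ← hc, ← hrc, map_mul, map_pow, Polynomial.toLaurent_X, T_pow, Polynomial.toLaurent_C,
    mul_comm (T _), mul_assoc, ← T_add, mul_one, sub_eq_add_neg]
  rcases Int.isUnit_iff.1 hr with rfl | rfl <;> simp

/-- The shift action of `ℤ` on Laurent polynomials. -/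
noncomputable def shift : Multiplicative ℤ →* MulAut (Multiplicative ℤ[T;T⁻¹]) where
  toFun z :=
    { toFun := fun p => ofAdd (T (toAdd z) * toAdd p)
      invFun := fun p => ofAdd (T (-toAdd z) * toAdd p)
      left_inv := fun p => by
        simp [← mul_assoc, ← T_add]
      right_inv := fun p => by
        simp [← mul_assoc, ← T_add]
      map_mul' := fun p q => by
        simp [mul_add] }
  map_one' := by
    ext p
    simp
  map_mul' := fun a b => by
    refine MulEquiv.ext fun p => ?_
    change ofAdd (T (toAdd a + toAdd b) * toAdd p) = ofAdd (T (toAdd a) * (T (toAdd b) * toAdd p))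
    rw [T_add, mul_assoc]

lemma shift_apply (z : Multiplicative ℤ) (p : Multiplicative ℤ[T;T⁻¹]) :
    shift z p = ofAdd (T (toAdd z) * toAdd p) := rfl

/-- Evaluation at `A`. -/
noncomputable def ev (A : GL2Z) : ℤ[T;T⁻¹] →ₐ[ℤ] Matrix (Fin 2) (Fin 2) ℤ :=
  AddMonoidAlgebra.lift ℤ _ ℤ ((Units.coeHom _).comp (zpowersHom _ A))

lemma ev_T (A : GL2Z) (k : ℤ) : ev A (T k) = mat (A ^ k) := by
  rw [ev, T, AddMonoidAlgebra.lift_single, one_smul]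
  rfl

lemma theta_aux (A : GL2Z) (w : Fin 2 → ℤ) (k : ℤ) (p : ℤ[T;T⁻¹]) :
    ofAdd (ev A (T k * p) *ᵥ w) = phiA A (ofAdd k) (ofAdd (ev A p *ᵥ w)) := by
  rw [phi_zpow, map_mul, ev_T, Matrix.mulVec_mulVec]

/-- The map from `ℤ[x^±1] ⋊ ℤ` to `G_A`. -/
noncomputable def theta (A : GL2Z) (w : Fin 2 → ℤ) :
    Multiplicative ℤ[T;T⁻¹] ⋊[shift] Multiplicative ℤ →* GA A :=
  SemidirectProduct.map
    (AddMonoidHom.toMultiplicative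
      { toFun := fun p => ev A p *ᵥ w
        map_zero' := by simp
        map_add' := fun p q => by simp [Matrix.add_mulVec] })
    (MonoidHom.id _) (by
      intro z
      refine MonoidHom.ext fun p => ?_
      exact theta_aux A w (toAdd z) (toAdd p))

lemma theta_left (A : GL2Z) (w : Fin 2 → ℤ) (g) :
    (theta A w g).left = ofAdd (ev A (toAdd g.left) *ᵥ w) := rfl

lemma theta_right (A : GL2Z) (w : Fin 2 → ℤ) (g) : (theta A w g).right = g.right := rfl

lemma rigid (A : GL2Z) (w v' w' : Fin 2 → ℤ)
    (h : NielsenEquiv ![tt A 0, el A w] ![tt A v', el A w']) :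
    ∃ (k : ℤ) (s : ℤ), (s = 1 ∨ s = -1) ∧ w' = s • (mat (A ^ k) *ᵥ w) := by
  obtain ⟨φ, hφ⟩ := h
  set S₀ : Fin 2 → Multiplicative ℤ[T;T⁻¹] ⋊[shift] Multiplicative ℤ :=
    ![⟨1, ofAdd 1⟩, ⟨ofAdd 1, 1⟩] with hS₀
  set π := FreeGroup.lift S₀ with hπ
  have hcomp : (theta A w).comp π = FreeGroup.lift ![tt A 0, el A w] := by
    ext1 i
    fin_cases i
    · simp only [hπ, hS₀, MonoidHom.comp_apply, FreeGroup.lift_apply_of]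
      refine SemidirectProduct.ext ?_ ?_
      · simp [theta_left, tt, -SemidirectProduct.mk_eq_inl_mul_inr]
      · simp [theta_right, tt, -SemidirectProduct.mk_eq_inl_mul_inr]
    · simp only [hπ, hS₀, MonoidHom.comp_apply, FreeGroup.lift_apply_of]
      refine SemidirectProduct.ext ?_ ?_
      · simp [theta_left, el, -SemidirectProduct.mk_eq_inl_mul_inr]
      · simp [theta_right, el, -SemidirectProduct.mk_eq_inl_mul_inr]
  have h0 : theta A w (π (φ (FreeGroup.of 0))) = tt A v' := by
    have := DFunLike.congr_fun hφ (FreeGroup.of 0)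
    rw [← hcomp] at this
    simpa using this
  have h1 : theta A w (π (φ (FreeGroup.of 1))) = el A w' := by
    have := DFunLike.congr_fun hφ (FreeGroup.of 1)
    rw [← hcomp] at this
    simpa using this
  set X := π (φ (FreeGroup.of 0)) with hX
  set Y := π (φ (FreeGroup.of 1)) with hY
  have hXr : X.right = ofAdd 1 := by rw [← theta_right A w, h0]; rfl
  have hYr : Y.right = 1 := by rw [← theta_right A w, h1]; rfl
  have hYl : ev A (toAdd Y.left) *ᵥ w = w' := by
    have := theta_left A w Y
    rw [h1] at this
    exact (Multiplicative.ofAdd.injective this).symm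
  have hX' : X = ⟨X.left, ofAdd 1⟩ := by rw [← hXr]
  have hY' : Y = ⟨Y.left, 1⟩ := by rw [← hYr]
  have hlift : FreeGroup.lift ![X, Y] = π.comp φ.toMonoidHom := by
    ext1 i
    fin_cases i <;> simp [hX, hY]
  have hmem : (SemidirectProduct.inl (ofAdd 1) :
      Multiplicative ℤ[T;T⁻¹] ⋊[shift] Multiplicative ℤ) ∈
      Subgroup.closure (Set.range ![X, Y]) := by
    rw [← FreeGroup.range_lift_eq_closure, hlift]
    refine ⟨φ.symm (FreeGroup.of 1), ?_⟩
    simp [hπ, hS₀]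
  rw [hX', hY'] at hmem
  have hN := normal_gen shift X.left Y.left
    (AddSubgroup.toSubgroup (Ideal.span {toAdd Y.left}).toAddSubgroup) ?_ ?_ ?_ _ hmem
  · have : (1 : ℤ[T;T⁻¹]) ∈ Ideal.span {toAdd Y.left} := hN
    obtain ⟨q, hq⟩ := Ideal.mem_span_singleton.1 this
    obtain ⟨k, s, hs, hk⟩ := laurent_unit _ q hq.symm
    refine ⟨k, s, hs, ?_⟩
    rw [← hYl, hk, map_zsmul, ev_T, Matrix.smul_mulVec]
  · intro n hn
    exact Ideal.mul_mem_left (Ideal.span {toAdd Y.left}) (T 1) hn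
  · intro n hn
    refine ⟨ofAdd (T (-1) * toAdd n),
      Ideal.mul_mem_left (Ideal.span {toAdd Y.left}) (T (-1)) hn, ?_⟩
    rw [shift_apply]
    simp [← mul_assoc, ← T_add]
  · exact Ideal.mem_span_singleton_self (toAdd Y.left)

lemma D_mat (A : GL2Z) (w : Fin 2 → ℤ) : D A (mat A *ᵥ w) = (mat A).det * D A w := by
  have := D_comb A w 0 1
  simpa using this

lemma D_zpow (A : GL2Z) (hd : (mat A).det = 1) (w : Fin 2 → ℤ) (k : ℤ) :
    D A (mat (A ^ k) *ᵥ w) = D A w := by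
  induction k using Int.induction_on with
  | zero => simp
  | succ i ih =>
    rw [← ih, add_comm, _root_.zpow_add, _root_.zpow_one, mat, Units.val_mul, ← Matrix.mulVec_mulVec,
      D_mat, hd, one_mul]
  | pred i ih =>
    rw [← ih]
    have : A ^ (-(i : ℤ)) = A * A ^ (-(i : ℤ) - 1) := by
      rw [← _root_.zpow_one_add]; congr 1; ring
    rw [this, mat, mat, Units.val_mul, ← Matrix.mulVec_mulVec, D_mat, hd, one_mul]

lemma D_smul (A : GL2Z) (w : Fin 2 → ℤ) (s : ℤ) : D A (s • w) = s ^ 2 * D A w := by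
  have := D_comb A w s 0
  simpa using this

lemma not_equiv (A : GL2Z) (hd : (mat A).det = 1) (w v' w' : Fin 2 → ℤ) (hw : D A w ≠ 0)
    (hw' : D A w' = - D A w) : ¬ NielsenEquiv ![tt A 0, el A w] ![tt A v', el A w'] := by
  intro h
  obtain ⟨k, s, hs, rfl⟩ := rigid A w v' w' h
  rw [D_smul, D_zpow A hd] at hw'
  have : s ^ 2 = 1 := by rcases hs with rfl | rfl <;> norm_num
  rw [this] at hw'
  omega

lemma trace_det_of_conj (A : GL2Z) (h : ConjPM21 A) :
    (mat A).det = 1 ∧ ((mat A).trace = 3 ∨ (mat A).trace = -3) := by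
  obtain ⟨P, h⟩ := h
  have h1 : (mat A).det = (mat (P * A * P⁻¹)).det := by
    simp only [mat, Units.val_mul, Matrix.det_mul]
    have : (P : Matrix (Fin 2) (Fin 2) ℤ).det * (P⁻¹ : GL2Z).val.det = 1 := by
      rw [← Matrix.det_mul, ← Units.val_mul]; simp
    linear_combination (-(A : Matrix (Fin 2) (Fin 2) ℤ).det) * this
  have h2 : (mat A).trace = (mat (P * A * P⁻¹)).trace := by
    simp only [mat, Units.val_mul]
    rw [Matrix.trace_mul_comm, ← mul_assoc, ← Units.val_mul]
    simp
  rcases h with h | h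
  · rw [h1, h2, mat, h]
    simp [Matrix.det_fin_two, Matrix.trace_fin_two]
  · rw [h1, h2, mat, h]
    simp [Matrix.det_fin_two, Matrix.trace_fin_two]

/-- Conjugacy from a cyclic vector. -/
lemma conj_of (A : GL2Z) (w : Fin 2 → ℤ) (hw : D A w ^ 2 = 1) (hd : (mat A).det = 1) (ε : ℤ)
    (hε : ε = 1 ∨ ε = -1) (ht : (mat A).trace = 3 * ε) : ConjPM21 A := by
  have hε2 : ε * ε = 1 := by rcases hε with rfl | rfl <;> norm_num
  set Q : Matrix (Fin 2) (Fin 2) ℤ :=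
    !![ε * (mat A *ᵥ w) 0 - w 0, w 0; ε * (mat A *ᵥ w) 1 - w 1, w 1] with hQ
  have hdet : Q.det = - ε * D A w := by
    rw [hQ, Matrix.det_fin_two, D]; simp; ring
  have hu : IsUnit Q.det := by
    rw [Int.isUnit_iff_natAbs_eq, hdet]
    rcases hε with rfl | rfl <;> rcases sq_eq_one' hw with h | h <;> rw [h] <;> rfl
  obtain ⟨P, hP⟩ := (Matrix.isUnit_iff_isUnit_det _).2 hu
  have key : mat A * Q = Q * (ε • !![2, 1; 1, 1]) := by
    have hc := cayley A w
    rw [ht, hd] at hc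
    have hc0 := congrFun hc 0
    have hc1 := congrFun hc 1
    simp only [Matrix.mulVec, dotProduct, Fin.sum_univ_two, Pi.sub_apply, Pi.smul_apply,
      smul_eq_mul] at hc0 hc1
    ext i j
    fin_cases i <;> fin_cases j <;>
      simp [hQ, Matrix.mul_apply, Fin.sum_univ_two]
    · linear_combination ε * hc0 + (mat A 0 0 * w 0 + mat A 0 1 * w 1) * hε2
    · linear_combination (-(mat A 0 0 * w 0 + mat A 0 1 * w 1)) * hε2
    · linear_combination ε * hc1 + (mat A 1 0 * w 0 + mat A 1 1 * w 1) * hε2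
    · linear_combination (-(mat A 1 0 * w 0 + mat A 1 1 * w 1)) * hε2
  have : ((P⁻¹ * A * P⁻¹⁻¹ : GL2Z) : Matrix (Fin 2) (Fin 2) ℤ) = ε • !![2, 1; 1, 1] := by
    rw [inv_inv, mul_assoc, Units.val_mul, Units.val_mul, hP, key, ← mul_assoc, ← hP,
      ← Units.val_mul]
    simp
  refine ⟨P⁻¹, ?_⟩
  rw [this]
  rcases hε with rfl | rfl
  · left; simp
  · right; simp

end Niel

theorem nielsen_classes_of_two_generated (A : GL2Z)
    (h2 : ∃ x y : GA A, Subgroup.closure {x, y} = ⊤) :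
    (¬ ConjPM21 A →
      ∀ S T : Fin 2 → GA A, Generates S → Generates T → NielsenEquiv S T) ∧
    (ConjPM21 A →
      ∃ S T : Fin 2 → GA A, Generates S ∧ Generates T ∧ ¬ NielsenEquiv S T ∧
        ∀ U : Fin 2 → GA A, Generates U → (NielsenEquiv U S ∨ NielsenEquiv U T)) := by
  open Niel in
  constructor
  · intro hA S T hS hT
    obtain ⟨w, hSw, hw⟩ := std A S hS
    obtain ⟨w', hTw, hw'⟩ := std A T hT
    refine Niel.trans hSw (Niel.trans ?_ (Niel.symm hTw))
    refine core A w hw (fun v => NielsenEquiv ![tt A 0, el A w] ![tt A 0, el A v])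
      ?_ ?_ (Niel.refl _) ?_ ?_ w' hw'
    · intro v h
      exact Niel.trans h (Niel.symm (nie_neg A v))
    · intro v
      exact ⟨fun h => Niel.trans h (nie_step A v), fun h => Niel.trans h (Niel.symm (nie_step A v))⟩
    · intro hd ht
      exact absurd (conj_of A w hw hd 1 (Or.inl rfl) (by simpa using ht)) hA
    · intro hd ht
      exact absurd (conj_of A w hw hd (-1) (Or.inr rfl) (by simpa using ht)) hA
  · intro hA
    obtain ⟨hd, ht⟩ := trace_det_of_conj A hA
    obtain ⟨x, y, hxy⟩ := h2
    obtain ⟨w, -, hw⟩ := std A ![x, y] (by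
      rw [Generates, ← hxy]
      congr 1
      ext z
      simp [eq_comm, or_comm])
    have hw0 : D A w ≠ 0 := by intro h; rw [h] at hw; norm_num at hw
    obtain ⟨b, hb, hDb, hb3⟩ : ∃ b : ℤ, (b = 1 ∨ b = -1) ∧
        D A ((1 : ℤ) • w + b • (mat A *ᵥ w)) = - D A w ∧ (mat A).trace = -3 * b := by
      rcases ht with ht | ht
      · refine ⟨-1, Or.inr rfl, ?_, by rw [ht]; norm_num⟩
        rw [D_comb, hd, ht]; ring
      · refine ⟨1, Or.inl rfl, ?_, by rw [ht]; norm_num⟩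
        rw [D_comb, hd, ht]; ring
    set w₁ := (1 : ℤ) • w + b • (mat A *ᵥ w) with hw₁
    refine ⟨![tt A 0, el A w], ![tt A 0, el A w₁], gen_of_D A w hw,
      gen_of_D A w₁ (by rw [hDb]; simpa using hw), not_equiv A hd w 0 w₁ hw0 hDb, ?_⟩
    intro U hU
    obtain ⟨w', hUw, hw'⟩ := std A U hU
    suffices H : NielsenEquiv ![tt A 0, el A w'] ![tt A 0, el A w] ∨
        NielsenEquiv ![tt A 0, el A w'] ![tt A 0, el A w₁] from
      H.imp (Niel.trans hUw) (Niel.trans hUw)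
    refine core A w hw (fun v => NielsenEquiv ![tt A 0, el A v] ![tt A 0, el A w] ∨
        NielsenEquiv ![tt A 0, el A v] ![tt A 0, el A w₁]) ?_ ?_ (Or.inl (Niel.refl _)) ?_ ?_ w' hw'
    · intro v h
      exact h.imp (Niel.trans (nie_neg A v)) (Niel.trans (nie_neg A v))
    · intro v
      exact ⟨fun h => h.imp (Niel.trans (Niel.symm (nie_step A v)))
        (Niel.trans (Niel.symm (nie_step A v))),
        fun h => h.imp (Niel.trans (nie_step A v)) (Niel.trans (nie_step A v))⟩
    · intro _ ht'
      have : b = -1 := by omega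
      subst this
      exact Or.inr (Niel.refl _)
    · intro _ ht'
      have : b = 1 := by omega
      subst this
      exact Or.inr (Niel.refl _)
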